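/- The ideal F satisfies F² = F, and both the left annihilator and the right annihilator of F in R are zero; that is, if r ∈ R satisfies rF = 0 then r = 0, and if rF... symmetrically if Fr = 0 then r = 0. -/

import Mathlib

/-!
`R = k⟨x,y⟩/⟨yx − 1⟩` is the associative `k`-algebra generated by `x` and `y`
with the single defining relation `y * x = 1` (the one-sided inverse of `k[x]`).
We realize it as the `RingQuot` of the free algebra on two generators.
-/

noncomputable section

/-- The defining relation `y * x = 1` on the free algebra `k⟨x,y⟩`. -/
inductive PreRel (k : Type) [Field k] : FreeAlgebra k (Fin 2) → FreeAlgebra k (Fin 2) → Prop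
  | yx : PreRel k (FreeAlgebra.ι k 1 * FreeAlgebra.ι k 0) 1

/-- `R = k⟨x,y⟩/⟨yx − 1⟩`. -/
abbrev R (k : Type) [Field k] := RingQuot (PreRel k)

/-- The generator `x` of `R`. -/
def Xg (k : Type) [Field k] : R k := RingQuot.mkAlgHom k (PreRel k) (FreeAlgebra.ι k 0)

/-- The generator `y` of `R`. -/
def Yg (k : Type) [Field k] : R k := RingQuot.mkAlgHom k (PreRel k) (FreeAlgebra.ι k 1)

/-- `F = ⟨1 − xy⟩`, the two-sided ideal of `R` generated by `1 − xy`. -/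
def Fideal (k : Type) [Field k] : TwoSidedIdeal (R k) :=
  TwoSidedIdeal.span {1 - Xg k * Yg k}

/-- The product of two two-sided ideals: the two-sided ideal generated by all
products `a * b` with `a ∈ I`, `b ∈ J`. -/
def tmul (k : Type) [Field k] (I J : TwoSidedIdeal (R k)) : TwoSidedIdeal (R k) :=
  TwoSidedIdeal.span {r : R k | ∃ a ∈ I, ∃ b ∈ J, r = a * b}

theorem yx_eq (k : Type) [Field k] : Yg k * Xg k = 1 := by
  have h := RingQuot.mkAlgHom_rel k (PreRel.yx (k := k))
  simpa [Xg, Yg] using h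

theorem R_induction (k : Type) [Field k] {P : R k → Prop}
    (hC : ∀ c : k, P (algebraMap k (R k) c)) (hx : P (Xg k)) (hy : P (Yg k))
    (hm : ∀ a b, P a → P b → P (a * b)) (ha : ∀ a b, P a → P b → P (a + b)) (r : R k) : P r := by
  obtain ⟨f, rfl⟩ := RingQuot.mkAlgHom_surjective k (PreRel k) r
  induction f using FreeAlgebra.induction with
  | grade0 c => simpa using hC c
  | grade1 i => fin_cases i <;> assumption
  | mul a b h1 h2 => rw [map_mul]; exact hm _ _ h1 h2
  | add a b h1 h2 => rw [map_add]; exact ha _ _ h1 h2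

theorem pow_yx (k : Type) [Field k] (n : ℕ) : Yg k ^ n * Xg k ^ n = 1 := by
  induction n with
  | zero => simp
  | succ n ih =>
    rw [pow_succ, pow_succ', mul_assoc, ← mul_assoc (Yg k) (Xg k), yx_eq, one_mul, ih]

open Polynomial in
theorem exists_right (k : Type) [Field k] (r : R k) :
    ∃ (n : ℕ) (p : k[X]), r * Xg k ^ n = aeval (Xg k) p := by
  induction r using R_induction with
  | hC c => exact ⟨0, C c, by simp⟩
  | hx => exact ⟨0, X, by simp⟩
  | hy => exact ⟨1, 1, by simp [yx_eq]⟩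
  | hm a b h1 h2 =>
    obtain ⟨n, p, hp⟩ := h1
    obtain ⟨m, q, hq⟩ := h2
    refine ⟨m + n, p * q, ?_⟩
    have hc : aeval (Xg k) q * Xg k ^ n = Xg k ^ n * aeval (Xg k) q := by
      have : q * X ^ n = X ^ n * q := mul_comm _ _
      simpa using congrArg (aeval (Xg k)) this
    rw [pow_add, mul_assoc, ← mul_assoc b, hq, hc, ← mul_assoc, hp, map_mul]
  | ha a b h1 h2 =>
    obtain ⟨n, p, hp⟩ := h1
    obtain ⟨m, q, hq⟩ := h2
    refine ⟨n + m, p * X ^ m + q * X ^ n, ?_⟩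
    rw [add_mul, pow_add, ← mul_assoc, hp, ← pow_add, add_comm n m, pow_add, ← mul_assoc, hq]
    simp

open Polynomial in
theorem exists_left (k : Type) [Field k] (r : R k) :
    ∃ (n : ℕ) (p : k[X]), Yg k ^ n * r = aeval (Yg k) p := by
  induction r using R_induction with
  | hC c => exact ⟨0, C c, by simp⟩
  | hx => exact ⟨1, 1, by simp [yx_eq]⟩
  | hy => exact ⟨0, X, by simp⟩
  | hm a b h1 h2 =>
    obtain ⟨n, p, hp⟩ := h1
    obtain ⟨m, q, hq⟩ := h2
    refine ⟨m + n, p * q, ?_⟩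
    have hc : Yg k ^ m * aeval (Yg k) p = aeval (Yg k) p * Yg k ^ m := by
      have : X ^ m * p = p * X ^ m := mul_comm _ _
      simpa using congrArg (aeval (Yg k)) this
    rw [pow_add, ← mul_assoc, mul_assoc _ _ a, hp, hc, mul_assoc, hq, map_mul]
  | ha a b h1 h2 =>
    obtain ⟨n, p, hp⟩ := h1
    obtain ⟨m, q, hq⟩ := h2
    refine ⟨m + n, X ^ m * p + X ^ n * q, ?_⟩
    rw [mul_add, pow_add, mul_assoc, hp, ← pow_add, add_comm m n, pow_add, mul_assoc, hq]
    simp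

/-- The shift-down operator on polynomials. -/
def shiftD (k : Type) [Field k] : Module.End k (Polynomial k) where
  toFun := Polynomial.divX
  map_add' _ _ := Polynomial.divX_add
  map_smul' c p := by ext; simp [Polynomial.coeff_divX]

/-- The action of `R` on polynomials. -/
def rho (k : Type) [Field k] : R k →ₐ[k] Module.End k (Polynomial k) :=
  RingQuot.liftAlgHom k ⟨FreeAlgebra.lift k
    ![Algebra.lmul k (Polynomial k) Polynomial.X, shiftD k], by
      rintro _ _ ⟨⟩
      ext n m
      simp [shiftD, Polynomial.coeff_divX, Polynomial.coeff_monomial]⟩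

theorem rho_x (k : Type) [Field k] :
    rho k (Xg k) = Algebra.lmul k (Polynomial k) Polynomial.X := by
  simp [rho, Xg]

theorem rho_y (k : Type) [Field k] : rho k (Yg k) = shiftD k := by
  simp [rho, Yg]

theorem rho_e (k : Type) [Field k] (q : Polynomial k) :
    rho k (1 - Xg k * Yg k) q = Polynomial.C (q.coeff 0) := by
  have h := Polynomial.X_mul_divX_add q
  simp only [map_sub, map_one, map_mul, rho_x, rho_y]
  simp only [LinearMap.sub_apply, Module.End.one_apply, Module.End.mul_apply]
  change q - Polynomial.X * q.divX = _
  rw [sub_eq_iff_eq_add, add_comm, h]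

open Polynomial in
theorem indep_right (k : Type) [Field k] (p : k[X])
    (h : aeval (Xg k) p * (1 - Xg k * Yg k) = 0) : p = 0 := by
  have h2 := congrArg (fun r => rho k r 1) h
  simp only [map_mul (rho k), Module.End.mul_apply, rho_e] at h2
  rw [← aeval_algHom_apply, rho_x, aeval_algHom_apply] at h2
  simpa using h2

open Polynomial in
theorem shiftD_pow (k : Type) [Field k] (i : ℕ) (q : k[X]) :
    ((shiftD k ^ i) q).coeff 0 = q.coeff i := by
  induction i generalizing q with
  | zero => simp
  | succ n ih =>
    rw [pow_succ, Module.End.mul_apply, ih]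
    exact coeff_divX

open Polynomial in
theorem indep_left (k : Type) [Field k] (p : k[X])
    (h : (1 - Xg k * Yg k) * aeval (Yg k) p = 0) : p = 0 := by
  ext j
  have h2 := congrArg (fun r => (rho k r (X ^ j)).coeff 0) h
  simp only [map_mul (rho k), Module.End.mul_apply, rho_e] at h2
  rw [← aeval_algHom_apply, rho_y, aeval_eq_sum_range] at h2
  simp only [LinearMap.sum_apply, LinearMap.smul_apply, finsetSum_coeff, coeff_smul,
    shiftD_pow, coeff_C_zero, coeff_X_pow, map_zero, LinearMap.zero_apply, coeff_zero] at h2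
  simp only [smul_eq_mul, mul_ite, mul_one, mul_zero, Finset.sum_ite_eq', Finset.mem_range] at h2
  split_ifs at h2 with h3
  · simpa using h2
  · simpa using coeff_eq_zero_of_natDegree_lt (by omega)

theorem e_mem (k : Type) [Field k] : 1 - Xg k * Yg k ∈ Fideal k :=
  TwoSidedIdeal.subset_span rfl

theorem one_sub_mem (k : Type) [Field k] (n : ℕ) : 1 - Xg k ^ n * Yg k ^ n ∈ Fideal k := by
  induction n with
  | zero => simpa using (Fideal k).zero_mem
  | succ n ih =>
    have : 1 - Xg k ^ (n+1) * Yg k ^ (n+1) = (1 - Xg k ^ n * Yg k ^ n)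
        + Xg k ^ n * (1 - Xg k * Yg k) * Yg k ^ n := by
      rw [pow_succ, pow_succ', mul_sub, sub_mul, mul_one]
      simp only [mul_assoc, sub_add_sub_cancel]
    rw [this]
    exact (Fideal k).add_mem ih
      ((Fideal k).mul_mem_right _ _ ((Fideal k).mul_mem_left _ _ (e_mem k)))

theorem e_idem (k : Type) [Field k] :
    1 - Xg k * Yg k = (1 - Xg k * Yg k) * (1 - Xg k * Yg k) := by
  have : Xg k * Yg k * (Xg k * Yg k) = Xg k * Yg k := by
    rw [mul_assoc, ← mul_assoc (Yg k), yx_eq, one_mul]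
  rw [mul_sub, sub_mul, sub_mul, this]; simp

/-- `F² = F`, and the left and right annihilators of `F` in `R` are zero:
if `r F = 0` then `r = 0`, and if `F r = 0` then `r = 0`. -/
theorem F_idempotent_and_annihilators_zero (k : Type) [Field k] :
    tmul k (Fideal k) (Fideal k) = Fideal k ∧
    (∀ r : R k, (∀ a ∈ Fideal k, r * a = 0) → r = 0) ∧
    (∀ r : R k, (∀ a ∈ Fideal k, a * r = 0) → r = 0) := by
  refine ⟨le_antisymm ?_ ?_, ?_, ?_⟩
  · refine TwoSidedIdeal.span_le.2 ?_
    rintro _ ⟨a, ha, b, hb, rfl⟩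
    exact (Fideal k).mul_mem_left _ _ hb
  · refine TwoSidedIdeal.span_le.2 ?_
    rintro _ rfl
    exact TwoSidedIdeal.subset_span ⟨_, e_mem k, _, e_mem k, e_idem k⟩
  · intro r hr
    obtain ⟨n, p, hp⟩ := exists_right k r
    have h0 : p = 0 := indep_right k p (by
      rw [← hp, mul_assoc]
      exact hr _ ((Fideal k).mul_mem_left _ _ (e_mem k)))
    have h1 := hr _ (one_sub_mem k n)
    rw [mul_sub, ← mul_assoc, hp, h0] at h1
    simpa using h1
  · intro r hr
    obtain ⟨n, p, hp⟩ := exists_left k r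
    have h0 : p = 0 := indep_left k p (by
      rw [← hp, ← mul_assoc]
      exact hr _ ((Fideal k).mul_mem_right _ _ (e_mem k)))
    have h1 := hr _ (one_sub_mem k n)
    rw [sub_mul, mul_assoc, hp, h0] at h1
    simpa using h1
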